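/- Let ℓ ≥ 1 be an integer, w a real number, and χ a smooth function on ℝ^{n+2} ∖ {0} that is homogeneous of degree w, i.e. X·∂ χ = w χ. Then □^ℓ(X² χ) = X² □^ℓ χ + 4ℓ (w + n/2 − ℓ + 2) □^{ℓ−1} χ. -/

import Mathlib

noncomputable section

/-- Partial derivative in coordinate direction `A` of a function on `ℝ^m`. -/
def pd {m : ℕ} (A : Fin m) (f : (Fin m → ℝ) → ℝ) : (Fin m → ℝ) → ℝ :=
  fun x => fderiv ℝ f x (Pi.single A 1)

/-- The Euler operator `X·∂`. -/
def euler {m : ℕ} (f : (Fin m → ℝ) → ℝ) : (Fin m → ℝ) → ℝ :=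
  fun x => ∑ A, x A * pd A f x

/-- The Laplacian `□ = η^{AB} ∂_A ∂_B` for the diagonal metric with entries `ε`. -/
def lap {m : ℕ} (ε : Fin m → ℝ) (f : (Fin m → ℝ) → ℝ) : (Fin m → ℝ) → ℝ :=
  fun x => ∑ A, ε A * pd A (pd A f) x

/-- `X² = η_{AB} X^A X^B` for the diagonal metric with entries `ε`. -/
def xsq {m : ℕ} (ε : Fin m → ℝ) (x : Fin m → ℝ) : ℝ :=
  ∑ A, ε A * x A ^ 2

/-- `ε` is a diagonal metric with all entries `±1` and exactly `q` entries equal to `-1`,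
i.e. a nondegenerate symmetric bilinear form of signature `(m - q, q)`. -/
def isSig {m : ℕ} (ε : Fin m → ℝ) (q : ℕ) : Prop :=
  (∀ A, ε A = 1 ∨ ε A = -1) ∧ Nat.card {A : Fin m // ε A = -1} = q

/-- The flat Thomas-D operator `D_A = 2(X·∂ + c)∂_A - X_A □` (with `c = n/2`). -/
def thomasD {m : ℕ} (ε : Fin m → ℝ) (c : ℝ) (A : Fin m) (f : (Fin m → ℝ) → ℝ) :
    (Fin m → ℝ) → ℝ :=
  fun x => 2 * (euler (pd A f) x + c * pd A f x) - ε A * x A * lap ε f x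

section

variable {m : ℕ} {U : Set (Fin m → ℝ)} {f g : (Fin m → ℝ) → ℝ}

theorem differentiableAt_of_contDiffOn (hU : IsOpen U) (hf : ContDiffOn ℝ (⊤ : ℕ∞) f U)
    {x : Fin m → ℝ} (hx : x ∈ U) : DifferentiableAt ℝ f x :=
  (hf.contDiffAt (hU.mem_nhds hx)).differentiableAt (by simp)

theorem contDiffOn_pd (hU : IsOpen U) (hf : ContDiffOn ℝ (⊤ : ℕ∞) f U) (A : Fin m) :
    ContDiffOn ℝ (⊤ : ℕ∞) (pd A f) U :=
  (hf.fderiv_of_isOpen hU (by simp)).clm_apply contDiffOn_const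

theorem contDiffOn_lap (hU : IsOpen U) (ε : Fin m → ℝ) (hf : ContDiffOn ℝ (⊤ : ℕ∞) f U) :
    ContDiffOn ℝ (⊤ : ℕ∞) (lap ε f) U :=
  ContDiffOn.sum fun A _ =>
    contDiffOn_const.mul (contDiffOn_pd hU (contDiffOn_pd hU hf A) A)

theorem pd_congr (hU : IsOpen U) (h : Set.EqOn f g U) (A : Fin m) :
    Set.EqOn (pd A f) (pd A g) U := fun x hx => by
  have : f =ᶠ[nhds x] g := Filter.eventuallyEq_of_mem (hU.mem_nhds hx) h
  simp only [pd, this.fderiv_eq]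

theorem lap_congr (hU : IsOpen U) (ε : Fin m → ℝ) (h : Set.EqOn f g U) :
    Set.EqOn (lap ε f) (lap ε g) U := fun x hx =>
  Finset.sum_congr rfl fun A _ => by rw [pd_congr hU (pd_congr hU h A) A hx]

theorem pd_add {x : Fin m → ℝ} (hf : DifferentiableAt ℝ f x) (hg : DifferentiableAt ℝ g x)
    (A : Fin m) : pd A (fun y => f y + g y) x = pd A f x + pd A g x := by
  simp only [pd, fderiv_fun_add hf hg, add_apply]

theorem pd_mul {x : Fin m → ℝ} (hf : DifferentiableAt ℝ f x) (hg : DifferentiableAt ℝ g x)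
    (A : Fin m) : pd A (fun y => f y * g y) x = f x * pd A g x + g x * pd A f x := by
  simp only [pd, fderiv_fun_mul hf hg, add_apply, smul_apply, smul_eq_mul]

theorem pd_const_mul {x : Fin m → ℝ} (hf : DifferentiableAt ℝ f x) (c : ℝ) (A : Fin m) :
    pd A (fun y => c * f y) x = c * pd A f x := by
  simp only [pd, fderiv_const_mul hf c, smul_apply, smul_eq_mul]

theorem pd_sum {ι : Type*} {s : Finset ι} {F : ι → (Fin m → ℝ) → ℝ} {x : Fin m → ℝ}
    (hF : ∀ i ∈ s, DifferentiableAt ℝ (F i) x) (A : Fin m) :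
    pd A (fun y => ∑ i ∈ s, F i y) x = ∑ i ∈ s, pd A (F i) x := by
  simp only [pd, fderiv_fun_sum hF, sum_apply]

theorem pd_coord (A B : Fin m) (x : Fin m → ℝ) :
    pd A (fun y => y B) x = if B = A then 1 else 0 := by
  simp only [pd, (hasFDerivAt_apply B x).fderiv, ContinuousLinearMap.proj_apply, Pi.single_apply]

theorem pd_comm (hU : IsOpen U) (hf : ContDiffOn ℝ (⊤ : ℕ∞) f U) (A B : Fin m)
    {x : Fin m → ℝ} (hx : x ∈ U) : pd A (pd B f) x = pd B (pd A f) x := by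
  have hd : DifferentiableAt ℝ (fderiv ℝ f) x :=
    ((hf.fderiv_of_isOpen hU (m := (⊤ : ℕ∞)) (by simp)).contDiffAt
      (hU.mem_nhds hx)).differentiableAt (by simp)
  have key (C D : Fin m) : pd C (pd D f) x
      = fderiv ℝ (fderiv ℝ f) x (Pi.single C 1) (Pi.single D 1) := by
    unfold pd
    rw [fderiv_clm_apply hd (differentiableAt_const _)]
    simp
  have hs : IsSymmSndFDerivAt ℝ f x :=
    (hf.contDiffAt (hU.mem_nhds hx)).isSymmSndFDerivAt (by
      simp only [minSmoothness_of_isRCLikeNormedField]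
      exact WithTop.coe_le_coe.2 le_top)
  rw [key, key, hs.eq]

theorem pd_xsq (ε : Fin m → ℝ) (A : Fin m) (x : Fin m → ℝ) :
    pd A (xsq ε) x = 2 * ε A * x A := by
  have h (B : Fin m) : pd A (fun y => ε B * y B ^ 2) x
      = if B = A then 2 * ε B * x B else 0 := by
    simp only [pow_two]
    rw [pd_const_mul (by fun_prop), pd_mul (by fun_prop) (by fun_prop), pd_coord]
    split_ifs <;> ring
  unfold xsq
  rw [pd_sum (by fun_prop)]
  simp [h]

theorem differentiable_xsq (ε : Fin m → ℝ) : Differentiable ℝ (xsq ε) := by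
  unfold xsq
  fun_prop

/-- A partial derivative lowers the degree of homogeneity by one. -/
theorem euler_pd (hU : IsOpen U) (hf : ContDiffOn ℝ (⊤ : ℕ∞) f U) {w : ℝ}
    (hom : Set.EqOn (euler f) (fun x => w * f x) U) (A : Fin m) :
    Set.EqOn (euler (pd A f)) (fun x => (w - 1) * pd A f x) U := fun x hx => by
  have hd (B : Fin m) : DifferentiableAt ℝ (pd B f) x :=
    differentiableAt_of_contDiffOn hU (contDiffOn_pd hU hf B) hx
  have h := pd_congr hU hom A hx
  rw [pd_const_mul (differentiableAt_of_contDiffOn hU hf hx)] at h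
  unfold euler at h ⊢
  rw [pd_sum fun B _ => DifferentiableAt.fun_mul (differentiableAt_apply B x) (hd B)] at h
  have h' (B : Fin m) : pd A (fun y => y B * pd B f y) x
      = x B * pd B (pd A f) x + if B = A then pd B f x else 0 := by
    rw [pd_mul (by fun_prop) (hd B), pd_coord, pd_comm hU hf A B hx]
    split_ifs <;> ring
  simp only [h', Finset.sum_add_distrib, Finset.sum_ite_eq', Finset.mem_univ, if_true] at h
  linarith

/-- The Laplacian lowers the degree of homogeneity by two. -/
theorem euler_lap (hU : IsOpen U) (hf : ContDiffOn ℝ (⊤ : ℕ∞) f U) {w : ℝ}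
    (hom : Set.EqOn (euler f) (fun x => w * f x) U) (ε : Fin m → ℝ) :
    Set.EqOn (euler (lap ε f)) (fun x => (w - 2) * lap ε f x) U := fun x hx => by
  have hd (A : Fin m) : DifferentiableAt ℝ (pd A (pd A f)) x :=
    differentiableAt_of_contDiffOn hU (contDiffOn_pd hU (contDiffOn_pd hU hf A) A) hx
  have h2 (A : Fin m) :=
    euler_pd hU (contDiffOn_pd hU hf A) (euler_pd hU hf hom A) A hx
  have h3 (B : Fin m) : pd B (lap ε f) x = ∑ A, ε A * pd B (pd A (pd A f)) x := by
    unfold lap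
    rw [pd_sum fun A _ => (hd A).const_mul _]
    exact Finset.sum_congr rfl fun A _ => pd_const_mul (hd A) _ _
  simp only [euler] at h2
  simp only [euler, h3, Finset.mul_sum]
  rw [Finset.sum_comm]
  simp only [lap, Finset.mul_sum]
  refine Finset.sum_congr rfl fun A _ => ?_
  have h4 : ∑ B, x B * (ε A * pd B (pd A (pd A f)) x)
      = ε A * ∑ B, x B * pd B (pd A (pd A f)) x := by
    rw [Finset.mul_sum]
    exact Finset.sum_congr rfl fun B _ => by ring
  rw [h4, h2]
  ring

/-- The commutator of the Laplacian with multiplication by `X²`. -/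
theorem lap_xsq_mul (hU : IsOpen U) (hf : ContDiffOn ℝ (⊤ : ℕ∞) f U) {ε : Fin m → ℝ}
    (hε : ∀ A, ε A * ε A = 1) {x : Fin m → ℝ} (hx : x ∈ U) :
    lap ε (fun y => xsq ε y * f y) x
      = xsq ε x * lap ε f x + 4 * euler f x + 2 * (m : ℝ) * f x := by
  have hd := differentiableAt_of_contDiffOn hU hf hx
  have hd' (A : Fin m) := differentiableAt_of_contDiffOn hU (contDiffOn_pd hU hf A) hx
  have h (A : Fin m) : pd A (pd A (fun y => xsq ε y * f y)) x
      = xsq ε x * pd A (pd A f) x + 4 * (ε A * (x A * pd A f x)) + 2 * ε A * f x := by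
    have h1 : Set.EqOn (pd A (fun y => xsq ε y * f y))
        (fun y => xsq ε y * pd A f y + f y * (2 * ε A * y A)) U := fun y hy => by
      rw [pd_mul (differentiable_xsq ε y) (differentiableAt_of_contDiffOn hU hf hy), pd_xsq]
    rw [pd_congr hU h1 A hx,
      pd_add ((differentiable_xsq ε x).fun_mul (hd' A)) (by fun_prop),
      pd_mul (differentiable_xsq ε x) (hd' A), pd_mul hd (by fun_prop),
      pd_const_mul (by fun_prop), pd_coord, pd_xsq, if_pos rfl]
    ring
  have h2 (A : Fin m) : ε A * pd A (pd A (fun y => xsq ε y * f y)) x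
      = xsq ε x * (ε A * pd A (pd A f) x) + 4 * (x A * pd A f x) + 2 * f x := by
    rw [h]
    linear_combination (4 * (x A * pd A f x) + 2 * f x) * hε A
  unfold lap euler
  simp only [h2, Finset.sum_add_distrib, ← Finset.mul_sum, Finset.sum_const, Finset.card_univ,
    Fintype.card_fin, nsmul_eq_mul]
  ring

theorem lap_add {x : Fin m → ℝ} (hU : IsOpen U) (hx : x ∈ U) (ε : Fin m → ℝ)
    (hf : ContDiffOn ℝ (⊤ : ℕ∞) f U) (hg : ContDiffOn ℝ (⊤ : ℕ∞) g U) :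
    lap ε (fun y => f y + g y) x = lap ε f x + lap ε g x := by
  unfold lap
  rw [← Finset.sum_add_distrib]
  refine Finset.sum_congr rfl fun A _ => ?_
  have h : Set.EqOn (pd A (fun y => f y + g y)) (fun y => pd A f y + pd A g y) U :=
    fun y hy => pd_add (differentiableAt_of_contDiffOn hU hf hy)
      (differentiableAt_of_contDiffOn hU hg hy) A
  rw [pd_congr hU h A hx, pd_add (differentiableAt_of_contDiffOn hU (contDiffOn_pd hU hf A) hx)
    (differentiableAt_of_contDiffOn hU (contDiffOn_pd hU hg A) hx), mul_add]

theorem lap_const_mul {x : Fin m → ℝ} (hU : IsOpen U) (hx : x ∈ U) (ε : Fin m → ℝ)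
    (hf : ContDiffOn ℝ (⊤ : ℕ∞) f U) (c : ℝ) :
    lap ε (fun y => c * f y) x = c * lap ε f x := by
  unfold lap
  rw [Finset.mul_sum]
  refine Finset.sum_congr rfl fun A _ => ?_
  have h : Set.EqOn (pd A (fun y => c * f y)) (fun y => c * pd A f y) U :=
    fun y hy => pd_const_mul (differentiableAt_of_contDiffOn hU hf hy) c A
  rw [pd_congr hU h A hx,
    pd_const_mul (differentiableAt_of_contDiffOn hU (contDiffOn_pd hU hf A) hx)]
  ring

theorem contDiffOn_lap_iterate (hU : IsOpen U) (ε : Fin m → ℝ)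
    (hf : ContDiffOn ℝ (⊤ : ℕ∞) f U) (k : ℕ) : ContDiffOn ℝ (⊤ : ℕ∞) ((lap ε)^[k] f) U := by
  induction k with
  | zero => exact hf
  | succ k ih =>
    rw [Function.iterate_succ_apply']
    exact contDiffOn_lap hU ε ih

theorem euler_lap_iterate (hU : IsOpen U) (hf : ContDiffOn ℝ (⊤ : ℕ∞) f U) {w : ℝ}
    (hom : Set.EqOn (euler f) (fun x => w * f x) U) (ε : Fin m → ℝ) (k : ℕ) :
    Set.EqOn (euler ((lap ε)^[k] f)) (fun x => (w - 2 * k) * (lap ε)^[k] f x) U := by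
  induction k with
  | zero => simpa using hom
  | succ k ih =>
    intro x hx
    rw [Function.iterate_succ_apply', euler_lap hU (contDiffOn_lap_iterate hU ε hf k) ih ε hx]
    push_cast
    ring

theorem lap_iterate_succ_xsq_mul (hU : IsOpen U) (hf : ContDiffOn ℝ (⊤ : ℕ∞) f U) {w : ℝ}
    (hom : Set.EqOn (euler f) (fun x => w * f x) U) {ε : Fin m → ℝ}
    (hε : ∀ A, ε A * ε A = 1) (k : ℕ) :
    Set.EqOn ((lap ε)^[k + 1] (fun y => xsq ε y * f y))
      (fun x => xsq ε x * (lap ε)^[k + 1] f x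
        + 4 * ((k : ℝ) + 1) * (w + (m : ℝ) / 2 - k) * (lap ε)^[k] f x) U := by
  induction k with
  | zero =>
    intro x hx
    have h := lap_xsq_mul hU hf hε hx
    rw [hom hx] at h
    simp only [zero_add, Function.iterate_one, Function.iterate_zero, id_eq, Nat.cast_zero, h]
    ring
  | succ k ih =>
    intro x hx
    have hs := contDiffOn_lap_iterate hU ε hf
    have hq : ContDiffOn ℝ (⊤ : ℕ∞) (xsq ε) U := by
      unfold xsq
      fun_prop
    rw [Function.iterate_succ_apply', lap_congr hU ε ih hx,
      lap_add hU hx ε (hq.mul (hs (k + 1))) (contDiffOn_const.mul (hs k)),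
      lap_const_mul hU hx ε (hs k), lap_xsq_mul hU (hs (k + 1)) hε hx,
      euler_lap_iterate hU hf hom ε (k + 1) hx,
      ← Function.iterate_succ_apply' (lap ε) k, ← Function.iterate_succ_apply' (lap ε) (k + 1)]
    push_cast
    ring

end

/-- for `χ` smooth on `ℝ^{n+2} ∖ {0}` homogeneous of degree `w`,
`□^ℓ(X² χ) = X² □^ℓ χ + 4ℓ(w + n/2 - ℓ + 2) □^{ℓ-1} χ`. -/
theorem lap_pow_xsq_mul
    (n : ℕ) (hn : 1 ≤ n) (ε : Fin (n + 2) → ℝ) (hsig : isSig ε 2)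
    (ℓ : ℕ) (hℓ : 1 ≤ ℓ) (w : ℝ) (χ : (Fin (n + 2) → ℝ) → ℝ)
    (hχ : ContDiffOn ℝ (⊤ : ℕ∞) χ {x | x ≠ 0})
    (hom : ∀ x : Fin (n + 2) → ℝ, x ≠ 0 → euler χ x = w * χ x) :
    ∀ x : Fin (n + 2) → ℝ, x ≠ 0 →
      (lap ε)^[ℓ] (fun y => xsq ε y * χ y) x
        = xsq ε x * (lap ε)^[ℓ] χ x
          + 4 * (ℓ : ℝ) * (w + (n : ℝ) / 2 - (ℓ : ℝ) + 2) * (lap ε)^[ℓ - 1] χ x := by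
  have hε (A : Fin (n + 2)) : ε A * ε A = 1 := by
    rcases hsig.1 A with h | h <;> simp [h]
  obtain ⟨k, rfl⟩ := Nat.exists_eq_add_of_le' hℓ
  intro x hx
  rw [lap_iterate_succ_xsq_mul isOpen_ne hχ hom hε k hx, Nat.add_sub_cancel]
  push_cast
  ring

end
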